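/- Let G be a graph with no long theta, and let K be a tidy shortest long near-prism in G. If x is a K-major vertex, then x has three pairwise nonadjacent neighbours in V(K). -/

import Mathlib

open SimpleGraph

namespace LEH

open scoped Classical

variable {V : Type*}

/-- `X` is anticomplete to `Y`: they are disjoint and there are no edges between them. -/
def Anticomplete (G : SimpleGraph V) (X Y : Set V) : Prop :=
  ∀ ⦃x⦄, x ∈ X → ∀ ⦃y⦄, y ∈ Y → x ≠ y ∧ ¬ G.Adj x y

/-- The vertex set of a walk. -/
def vset {G : SimpleGraph V} {u v : V} (P : G.Walk u v) : Set V :=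
  {x | x ∈ P.support}

/-- The interior of a path: its non-end vertices. -/
def inter {G : SimpleGraph V} {u v : V} (P : G.Walk u v) : Set V :=
  {x | x ∈ P.support ∧ x ≠ u ∧ x ≠ v}

/-- An induced path in `G`. -/
def IsInducedPath {G : SimpleGraph V} {u v : V} (P : G.Walk u v) : Prop :=
  P.IsPath ∧ ∀ x ∈ P.support, ∀ y ∈ P.support, G.Adj x y → s(x, y) ∈ P.edges

/-- A hole: an induced cycle of length at least 4. -/
def IsHole {G : SimpleGraph V} {u : V} (c : G.Walk u u) : Prop :=
  c.IsCycle ∧ 4 ≤ c.length ∧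
    ∀ x ∈ c.support, ∀ y ∈ c.support, G.Adj x y → s(x, y) ∈ c.edges

/-- A long even hole: a hole of even length at least `ℓ`. -/
def IsLongEvenHole (ℓ : ℕ) {G : SimpleGraph V} {u : V} (c : G.Walk u u) : Prop :=
  IsHole c ∧ ℓ ≤ c.length ∧ Even c.length

def HasLongEvenHole (G : SimpleGraph V) (ℓ : ℕ) : Prop :=
  ∃ (u : V) (c : G.Walk u u), IsLongEvenHole ℓ c

/-- A long theta in `G`: two nonadjacent vertices joined by three internally disjoint
induced paths with no edges between their interiors, any two of which form a long hole. -/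
def HasLongTheta (G : SimpleGraph V) (ℓ : ℕ) : Prop :=
  ∃ (u v : V) (P₁ P₂ P₃ : G.Walk u v),
    u ≠ v ∧ ¬ G.Adj u v ∧
    IsInducedPath P₁ ∧ IsInducedPath P₂ ∧ IsInducedPath P₃ ∧
    Anticomplete G (inter P₁) (inter P₂) ∧
    Anticomplete G (inter P₁) (inter P₃) ∧
    Anticomplete G (inter P₂) (inter P₃) ∧
    ℓ ≤ P₁.length + P₂.length ∧ ℓ ≤ P₁.length + P₃.length ∧
    ℓ ≤ P₂.length + P₃.length

/-- A long jewel of order `k` formed by `Q₁, Q₂, P`. -/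
def IsLongJewel (ℓ k : ℕ) {G : SimpleGraph V} {u v : V}
    (Q₁ Q₂ P : G.Walk u v) : Prop :=
  u ≠ v ∧
  IsInducedPath Q₁ ∧ IsInducedPath Q₂ ∧ IsInducedPath P ∧
  ¬ (Even Q₁.length ↔ Even Q₂.length) ∧
  max Q₁.support.length Q₂.support.length = k ∧
  ℓ ≤ P.length + min Q₁.length Q₂.length ∧
  Anticomplete G (inter P) (inter Q₁ ∪ inter Q₂)

def HasLongJewel (G : SimpleGraph V) (ℓ k : ℕ) : Prop :=
  ∃ (u v : V) (Q₁ Q₂ P : G.Walk u v), IsLongJewel ℓ k Q₁ Q₂ P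

/-- A long ban-the-bomb in `G`. -/
def IsLongBanTheBomb (ℓ : ℕ) {G : SimpleGraph V} (u v₁ w v₂ x : V)
    (P₁ : G.Walk x v₁) (P₂ : G.Walk x v₂) : Prop :=
  G.Adj u v₁ ∧ G.Adj v₁ w ∧ G.Adj w v₂ ∧ G.Adj v₂ u ∧ ¬ G.Adj v₁ v₂ ∧ u ≠ w ∧
  G.Adj x u ∧ ¬ G.Adj x v₁ ∧ ¬ G.Adj x v₂ ∧ ¬ G.Adj x w ∧
  x ≠ v₁ ∧ x ≠ v₂ ∧ x ≠ w ∧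
  IsInducedPath P₁ ∧ IsInducedPath P₂ ∧
  2 ≤ P₁.length ∧ 2 ≤ P₂.length ∧
  Anticomplete G (inter P₁) {u, w} ∧ Anticomplete G (inter P₂) {u, w} ∧
  Anticomplete G (vset P₁ \ {x}) (vset P₂ \ {x}) ∧
  ℓ ≤ P₁.length + 2 ∧ ℓ ≤ P₂.length + 2 ∧ ℓ ≤ P₁.length + P₂.length + 2

def HasLongBanTheBomb (G : SimpleGraph V) (ℓ : ℕ) : Prop :=
  ∃ (u v₁ w v₂ x : V) (P₁ : G.Walk x v₁) (P₂ : G.Walk x v₂),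
    IsLongBanTheBomb ℓ u v₁ w v₂ x P₁ P₂

/-- The induced subgraph of `G` on the vertex set `S` is a long hole. -/
def IsLongHoleOn (G : SimpleGraph V) (ℓ : ℕ) (S : Set V) : Prop :=
  ∃ (u : V) (c : G.Walk u u), IsHole c ∧ ℓ ≤ c.length ∧ {x | x ∈ c.support} = S

/-- A long near-prism with triangles `{a 0, a 1, a 2}`, `{b 0, b 1, b 2}` and
constituent paths `P 0, P 1, P 2`. -/
def IsLongNearPrism (ℓ : ℕ) {G : SimpleGraph V} (a b : Fin 3 → V)
    (P : ∀ i : Fin 3, G.Walk (a i) (b i)) : Prop :=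
  (∀ i j, i ≠ j → G.Adj (a i) (a j)) ∧
  (∀ i j, i ≠ j → G.Adj (b i) (b j)) ∧
  (Set.range a ∩ Set.range b).Subsingleton ∧
  (∀ i, (P i).IsPath) ∧
  (∀ i j, i ≠ j → ∀ x, x ∈ (P i).support → x ∉ (P j).support) ∧
  (∀ i j, i ≠ j → IsLongHoleOn G ℓ (vset (P i) ∪ vset (P j)))

def HasLongNearPrism (G : SimpleGraph V) (ℓ : ℕ) : Prop :=
  ∃ (a b : Fin 3 → V) (P : ∀ i : Fin 3, G.Walk (a i) (b i)), IsLongNearPrism ℓ a b P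

/-- A prospect: no long even hole of length at most `2ℓ`, no long jewel of order at most
`ℓ+1`, no long theta and no long ban-the-bomb. -/
def Prospect (G : SimpleGraph V) (ℓ : ℕ) : Prop :=
  (¬ ∃ (u : V) (c : G.Walk u u), IsLongEvenHole ℓ c ∧ c.length ≤ 2 * ℓ) ∧
  (¬ ∃ k ≤ ℓ + 1, HasLongJewel G ℓ k) ∧
  ¬ HasLongTheta G ℓ ∧ ¬ HasLongBanTheBomb G ℓ

/-- A candidate : a prospect with no long near-prism. -/
def Candidate (G : SimpleGraph V) (ℓ : ℕ) : Prop :=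
  Prospect G ℓ ∧ ¬ HasLongNearPrism G ℓ

/-- The vertex set of a near-prism. -/
def prismSupport {G : SimpleGraph V} {a b : Fin 3 → V}
    (P : ∀ i : Fin 3, G.Walk (a i) (b i)) : Set V :=
  ⋃ i, vset (P i)

/-- The near-prism, as a graph on `V`. -/
def prismGraph (G : SimpleGraph V) (a b : Fin 3 → V)
    (P : ∀ i : Fin 3, G.Walk (a i) (b i)) : SimpleGraph V :=
  SimpleGraph.fromEdgeSet
    ({e | ∃ i j, i ≠ j ∧ e = s(a i, a j)} ∪ {e | ∃ i j, i ≠ j ∧ e = s(b i, b j)} ∪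
      {e | ∃ i, e ∈ (P i).edges})

/-- `q` is `K`-major: `q` is outside the near-prism `K`, and no path of `K` with at most
three vertices contains all neighbours of `q` in `V(K)`. -/
def KMajor (G : SimpleGraph V) {a b : Fin 3 → V}
    (P : ∀ i : Fin 3, G.Walk (a i) (b i)) (q : V) : Prop :=
  q ∉ prismSupport P ∧
  ¬ ∃ (x y : V) (W : (prismGraph G a b P).Walk x y), W.IsPath ∧ W.length ≤ 2 ∧
      ∀ z ∈ prismSupport P, G.Adj q z → z ∈ W.support

/-- A shortest long near-prism. -/
def ShortestLNP (G : SimpleGraph V) (ℓ : ℕ) {a b : Fin 3 → V}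
    (P : ∀ i : Fin 3, G.Walk (a i) (b i)) : Prop :=
  IsLongNearPrism ℓ a b P ∧
  ∀ (a' b' : Fin 3 → V) (P' : ∀ i : Fin 3, G.Walk (a' i) (b' i)),
    IsLongNearPrism ℓ a' b' P' → (prismSupport P).ncard ≤ (prismSupport P').ncard

/-- The interior `F_K*` of the frame of a long near-prism: for each constituent path,
either the whole path (if it has length at most `ℓ-1`), or the non-end vertices of the
two stubs of length `ℓ/2 - 1` at its two ends. -/
def frameStar (ℓ : ℕ) {G : SimpleGraph V} {a b : Fin 3 → V}
    (P : ∀ i : Fin 3, G.Walk (a i) (b i)) : Set V :=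
  ⋃ i,
    if (P i).length ≤ ℓ - 1 then vset (P i)
    else {x | x ∈ (P i).support.take (ℓ / 2 - 1)} ∪
      {x | x ∈ (P i).support.reverse.take (ℓ / 2 - 1)}

/-- A long near-prism is tidy: it contains a frame (so at most one constituent path has
length at most `ℓ-1`) whose interior is anticomplete to the rest of the graph. -/
def Tidy (G : SimpleGraph V) (ℓ : ℕ) {a b : Fin 3 → V}
    (P : ∀ i : Fin 3, G.Walk (a i) (b i)) : Prop :=
  (∀ i j, (P i).length ≤ ℓ - 1 → (P j).length ≤ ℓ - 1 → i = j) ∧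
  Anticomplete G (frameStar ℓ P) {x | x ∉ prismSupport P}

/-- The index of the first neighbour of `x` in the list `l`. -/
noncomputable def firstNbrIdx (G : SimpleGraph V) (l : List V) (x : V) : ℕ :=
  l.findIdx (fun y => decide (G.Adj x y))

/-- `α(x)`: the neighbour of `x` on `P` nearest to the first end of `P`. -/
noncomputable def alpha (G : SimpleGraph V) {u w : V} (P : G.Walk u w) (x : V) : V :=
  P.support.getD (firstNbrIdx G P.support x) u

/-- `β(x)`: the neighbour of `x` on `P` nearest to the last end of `P`. -/
noncomputable def beta (G : SimpleGraph V) {u w : V} (P : G.Walk u w) (x : V) : V :=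
  P.support.reverse.getD (firstNbrIdx G P.support.reverse x) w

/-- `A(x)`: the vertex set of the subpath of `P` from its first end to `α(x)` if `x` has
a neighbour on `P`, and all of `V(P)` otherwise. -/
noncomputable def Aset (G : SimpleGraph V) {u w : V} (P : G.Walk u w) (x : V) : Set V :=
  if ∃ y ∈ P.support, G.Adj x y then
    {z | z ∈ P.support.take (firstNbrIdx G P.support x + 1)}
  else vset P

noncomputable def A123 (G : SimpleGraph V) {a b : Fin 3 → V}
    (P : ∀ i : Fin 3, G.Walk (a i) (b i)) (x : V) : Set V :=
  ⋃ i, Aset G (P i) x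

/-- The index of `v` in the list `l`. -/
noncomputable def listIdx (l : List V) (v : V) : ℕ :=
  l.findIdx (fun z => decide (z = v))

/-- `K^m_n(v)`: the union of the maximal subpath of `P` from `v` towards the first end of
`P` of length at most `m` with no internal vertex in `Fs`, and the maximal subpath of `P`
from `v` towards the last end of `P` of length at most `n` with no internal vertex in `Fs`. -/
noncomputable def Kmn (G : SimpleGraph V) (Fs : Set V) {u w : V}
    (P : G.Walk u w) (v : V) (m n : ℕ) : Set V :=
  let t := listIdx P.support v
  {z | ∃ r, r ≤ t ∧ t - r ≤ m ∧
      (∀ q, r < q → q < t → P.support.getD q v ∉ Fs) ∧ z = P.support.getD r v} ∪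
  {z | ∃ r, t ≤ r ∧ r < P.support.length ∧ r - t ≤ n ∧
      (∀ q, t < q → q < r → P.support.getD q v ∉ Fs) ∧ z = P.support.getD r v}

/-- `y` is distant from `x` (both `K`-major), for a tidy near-prism. -/
def Distant (G : SimpleGraph V) (ℓ : ℕ) {a b : Fin 3 → V}
    (P : ∀ i : Fin 3, G.Walk (a i) (b i)) (x y : V) : Prop :=
  ¬ G.Adj x y ∧
  (∃ z ∈ A123 G P x, G.Adj y z) ∧
  (∀ i, (∃ z ∈ (P i).support, G.Adj x z) →
    ∀ z ∈ Kmn G (frameStar ℓ P) (P i) (alpha G (P i) x) (ℓ - 2) 1, ¬ G.Adj y z) ∧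
  (∀ i, (¬ ∃ z ∈ (P i).support, G.Adj x z) →
    ∃ j, j ≠ i ∧
      ∀ z ∈ Kmn G (frameStar ℓ P) (P j) (beta G (P j) x) 0 (ℓ - 3), ¬ G.Adj y z)

/-- The hole `c`, regarded as a graph on `V`. -/
def holeGraph (G : SimpleGraph V) {u : V} (c : G.Walk u u) : SimpleGraph V :=
  SimpleGraph.fromEdgeSet {e | e ∈ c.edges}

/-- The distance between two vertices in the hole `c`. -/
noncomputable def holeDist (G : SimpleGraph V) {u : V} (c : G.Walk u u) (x y : V) : ℕ :=
  (holeGraph G c).dist x y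

/-- `x` is `C`-major for the hole `c`: `x` is not on `c` and no path of `c` with at most
three vertices contains all neighbours of `x` on `c`. -/
def CMajor (G : SimpleGraph V) {u : V} (c : G.Walk u u) (x : V) : Prop :=
  x ∉ c.support ∧
  ¬ ∃ q ∈ c.support, ∀ z ∈ c.support, G.Adj x z → z = q ∨ s(q, z) ∈ c.edges

/-- A shortest long even hole. -/
def ShortestLEH (G : SimpleGraph V) (ℓ : ℕ) {u : V} (c : G.Walk u u) : Prop :=
  IsLongEvenHole ℓ c ∧
  ∀ (v : V) (c' : G.Walk v v), IsLongEvenHole ℓ c' → c.length ≤ c'.length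

/-- `L₁, L₂` are the two `x y`-paths of the hole `c`. -/
def ArcPair {G : SimpleGraph V} {u : V} (c : G.Walk u u) {x y : V}
    (L₁ L₂ : G.Walk x y) : Prop :=
  L₁.IsPath ∧ L₂.IsPath ∧
  (∀ e ∈ L₁.edges, e ∈ c.edges) ∧ (∀ e ∈ L₂.edges, e ∈ c.edges) ∧
  (∀ e ∈ c.edges, e ∈ L₁.edges ∨ e ∈ L₂.edges) ∧
  (∀ e ∈ L₁.edges, e ∉ L₂.edges)

/-- `X` is lighter than `Y`, with respect to the linear order on edges given by `idx`. -/
def Lighter [DecidableEq V] (idx : Sym2 V → ℕ) (X Y : Finset (Sym2 V)) : Prop :=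
  X.card < Y.card ∨
  (X.card = Y.card ∧ ∃ e ∈ Y, e ∉ X ∧
    ∀ f : Sym2 V, ((f ∈ X ∧ f ∉ Y) ∨ (f ∈ Y ∧ f ∉ X)) → idx e ≤ idx f)

/-- The lightest long even hole. -/
def LightestLEH [DecidableEq V] (G : SimpleGraph V) (ℓ : ℕ) (idx : Sym2 V → ℕ)
    {u : V} (c : G.Walk u u) : Prop :=
  IsLongEvenHole ℓ c ∧
  ∀ (v : V) (c' : G.Walk v v), IsLongEvenHole ℓ c' →
    c'.edges.toFinset ≠ c.edges.toFinset →
    Lighter idx c.edges.toFinset c'.edges.toFinset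

/-- A `(C,x)`-gap: a path of the hole `c` of length at least two whose ends are adjacent
to `x` and none of whose interior vertices is adjacent to `x`. -/
def IsGap (G : SimpleGraph V) {u : V} (c : G.Walk u u) (x : V) {p₁ p₂ : V}
    (P : G.Walk p₁ p₂) : Prop :=
  P.IsPath ∧ (∀ e ∈ P.edges, e ∈ c.edges) ∧ 2 ≤ P.length ∧
  G.Adj x p₁ ∧ G.Adj x p₂ ∧ ∀ z ∈ inter P, ¬ G.Adj x z

end LEH

open LEH

namespace LEH

/-- `G` has an induced path from `u` to `v` of length `n` with vertex set `S`. -/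
def IndPathOn {V : Type*} (G : SimpleGraph V) (u v : V) (S : Set V) (n : ℕ) : Prop :=
  ∃ Q : G.Walk u v, IsInducedPath Q ∧ vset Q = S ∧ Q.length = n

section InducedPaths

variable {V : Type*} {G : SimpleGraph V}

theorem IndPathOn.single (u : V) : IndPathOn G u u {u} 0 := by
  refine ⟨Walk.nil, ⟨by simp, ?_⟩, by ext; simp [vset], rfl⟩
  intro x hx y hy h
  simp only [Walk.support_nil, List.mem_singleton] at hx hy
  subst hx; subst hy
  exact absurd rfl h.ne

theorem IndPathOn.reverse {u v : V} {S : Set V} {n : ℕ} (h : IndPathOn G u v S n) :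
    IndPathOn G v u S n := by
  obtain ⟨Q, ⟨hp, hi⟩, hS, hn⟩ := h
  refine ⟨Q.reverse, ⟨hp.reverse, ?_⟩, ?_, by simpa using hn⟩
  · simpa using hi
  · rw [← hS]; ext; simp [vset]

theorem IndPathOn.join {u v v' w : V} {S T : Set V} {m n : ℕ}
    (h₁ : IndPathOn G u v S m) (h₂ : IndPathOn G v' w T n) (hvv' : G.Adj v v')
    (hdisj : ∀ x ∈ S, ∀ y ∈ T, x ≠ y)
    (hcross : ∀ x ∈ S, ∀ y ∈ T, G.Adj x y → x = v ∧ y = v') :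
    IndPathOn G u w (S ∪ T) (m + n + 1) := by
  obtain ⟨Q, ⟨hp, hi⟩, rfl, rfl⟩ := h₁
  obtain ⟨R, ⟨hp', hi'⟩, rfl, rfl⟩ := h₂
  refine ⟨Q.append (Walk.cons hvv' R), ⟨?_, ?_⟩, ?_, ?_⟩
  · rw [Walk.isPath_def, Walk.support_append]
    simp only [Walk.support_cons, List.tail_cons]
    exact hp.support_nodup.append hp'.support_nodup (fun a ha hb => hdisj a ha a hb rfl)
  · intro x hx y hy hxy
    simp only [Walk.mem_support_append_iff, Walk.support_cons, List.mem_cons] at hx hy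
    simp only [Walk.edges_append, Walk.edges_cons, List.mem_append, List.mem_cons]
    have hx' : x ∈ Q.support ∨ x ∈ R.support := by
      rcases hx with h | rfl | h
      exacts [Or.inl h, Or.inl Q.end_mem_support, Or.inr h]
    have hy' : y ∈ Q.support ∨ y ∈ R.support := by
      rcases hy with h | rfl | h
      exacts [Or.inl h, Or.inl Q.end_mem_support, Or.inr h]
    rcases hx' with hx | hx <;> rcases hy' with hy | hy
    · exact Or.inl (hi x hx y hy hxy)
    · obtain ⟨rfl, rfl⟩ := hcross x hx y hy hxy
      exact Or.inr (Or.inl rfl)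
    · obtain ⟨rfl, rfl⟩ := hcross y hy x hx hxy.symm
      exact Or.inr (Or.inl Sym2.eq_swap)
    · exact Or.inr (Or.inr (hi' x hx y hy hxy))
  · ext z
    simp only [vset, Set.mem_ofPred_eq, Set.mem_union, Walk.mem_support_append_iff,
      Walk.support_cons, List.mem_cons]
    constructor
    · rintro (h | rfl | h)
      exacts [Or.inl h, Or.inl Q.end_mem_support, Or.inr h]
    · rintro (h | h)
      exacts [Or.inl h, Or.inr (Or.inr h)]
  · simp [Walk.length_append]; omega

theorem IndPathOn.isLongHoleOn {ℓ : ℕ} {u v u' v' : V} {S T : Set V} {m n : ℕ}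
    (h₁ : IndPathOn G u v S m) (h₂ : IndPathOn G u' v' T n)
    (huu' : G.Adj u u') (hvv' : G.Adj v v')
    (hdisj : ∀ x ∈ S, ∀ y ∈ T, x ≠ y)
    (hcross : ∀ x ∈ S, ∀ y ∈ T, G.Adj x y → (x = u ∧ y = u') ∨ (x = v ∧ y = v'))
    (h4 : 4 ≤ ℓ) (hlen : ℓ ≤ m + n + 2) :
    IsLongHoleOn G ℓ (S ∪ T) := by
  obtain ⟨Q, ⟨hp, hi⟩, rfl, rfl⟩ := h₁
  obtain ⟨R, ⟨hp', hi'⟩, rfl, rfl⟩ := h₂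
  have hpath : (Q.append (Walk.cons hvv' R.reverse)).IsPath := by
    rw [Walk.isPath_def, Walk.support_append]
    simp only [Walk.support_cons, List.tail_cons, Walk.support_reverse]
    refine hp.support_nodup.append (List.nodup_reverse.2 hp'.support_nodup) ?_
    intro a ha hb
    exact hdisj a ha a (List.mem_reverse.1 hb) rfl
  refine ⟨u', Walk.cons huu'.symm (Q.append (Walk.cons hvv' R.reverse)), ⟨?_, ?_, ?_⟩, ?_, ?_⟩
  · rw [Walk.cons_isCycle_iff]
    refine ⟨hpath, fun he => ?_⟩
    simp only [Walk.edges_append, Walk.edges_cons, List.mem_append, List.mem_cons,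
      Walk.edges_reverse, List.mem_reverse] at he
    rcases he with he | he | he
    · exact hdisj u' (Q.fst_mem_support_of_mem_edges he) u' R.start_mem_support rfl
    · rw [Sym2.eq_iff] at he
      rcases he with ⟨h, -⟩ | ⟨h, h'⟩
      · exact hdisj v Q.end_mem_support u' R.start_mem_support h.symm
      · subst h; subst h'
        have h1 := Walk.length_eq_zero_iff.2 (Walk.isPath_iff_nil.1 hp)
        have h2 := Walk.length_eq_zero_iff.2 (Walk.isPath_iff_nil.1 hp')
        omega
    · exact hdisj u Q.start_mem_support u (R.snd_mem_support_of_mem_edges he) rfl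
  · simp [Walk.length_append]; omega
  · intro x hx y hy hxy
    simp only [Walk.mem_support_append_iff, Walk.support_cons, List.mem_cons,
      Walk.support_reverse, List.mem_reverse] at hx hy
    simp only [Walk.edges_append, Walk.edges_cons, List.mem_append, List.mem_cons,
      Walk.edges_reverse, List.mem_reverse]
    have hx' : x ∈ Q.support ∨ x ∈ R.support := by
      rcases hx with rfl | h | rfl | h
      exacts [Or.inr R.start_mem_support, Or.inl h, Or.inl Q.end_mem_support, Or.inr h]
    have hy' : y ∈ Q.support ∨ y ∈ R.support := by
      rcases hy with rfl | h | rfl | h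
      exacts [Or.inr R.start_mem_support, Or.inl h, Or.inl Q.end_mem_support, Or.inr h]
    rcases hx' with hx | hx <;> rcases hy' with hy | hy
    · exact Or.inr (Or.inl (hi x hx y hy hxy))
    · rcases hcross x hx y hy hxy with ⟨rfl, rfl⟩ | ⟨rfl, rfl⟩
      · exact Or.inl Sym2.eq_swap
      · exact Or.inr (Or.inr (Or.inl rfl))
    · rcases hcross y hy x hx hxy.symm with ⟨rfl, rfl⟩ | ⟨rfl, rfl⟩
      · exact Or.inl rfl
      · exact Or.inr (Or.inr (Or.inl Sym2.eq_swap))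
    · exact Or.inr (Or.inr (Or.inr (hi' x hx y hy hxy)))
  · simp [Walk.length_append]; omega
  · ext z
    simp only [vset, Set.mem_ofPred_eq, Set.mem_union, Walk.mem_support_append_iff,
      Walk.support_cons, List.mem_cons, Walk.support_reverse, List.mem_reverse]
    constructor
    · rintro (rfl | h | rfl | h)
      exacts [Or.inr R.start_mem_support, Or.inl h, Or.inl Q.end_mem_support, Or.inr h]
    · rintro (h | h)
      exacts [Or.inr (Or.inl h), Or.inr (Or.inr (Or.inr h))]

theorem indPathOn_image_Icc {f : ℕ → V} {N : ℕ}
    (hadj : ∀ s < N, G.Adj (f s) (f (s + 1)))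
    (hinj : ∀ s ≤ N, ∀ t ≤ N, f s = f t → s = t)
    (hind : ∀ s ≤ N, ∀ t ≤ N, G.Adj (f s) (f t) → s + 1 = t ∨ t + 1 = s)
    {s t : ℕ} (hst : s ≤ t) (ht : t ≤ N) :
    IndPathOn G (f s) (f t) (f '' Set.Icc s t) (t - s) := by
  induction t, hst using Nat.le_induction with
  | base => simpa using IndPathOn.single (G := G) (f s)
  | succ t hst ih =>
    have h := (ih (by omega)).join (IndPathOn.single (f (t + 1))) (hadj t (by omega))
      (by
        rintro _ ⟨i, ⟨h1, h2⟩, rfl⟩ _ rfl he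
        have := hinj i (by omega) (t + 1) ht he
        omega)
      (by
        rintro _ ⟨i, ⟨h1, h2⟩, rfl⟩ _ rfl he
        have := hind i (by omega) (t + 1) ht he
        have : i = t := by omega
        subst this
        exact ⟨rfl, rfl⟩)
    have hS : f '' Set.Icc s (t + 1) = f '' Set.Icc s t ∪ {f (t + 1)} := by
      ext z
      simp only [Set.mem_image, Set.mem_Icc, Set.mem_union, Set.mem_singleton_iff]
      constructor
      · rintro ⟨i, ⟨h1, h2⟩, rfl⟩
        rcases Nat.lt_or_ge t i with h3 | h3
        · right; congr 1; omega
        · exact Or.inl ⟨i, ⟨h1, h3⟩, rfl⟩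
      · rintro (⟨i, ⟨h1, h2⟩, rfl⟩ | rfl)
        · exact ⟨i, ⟨h1, by omega⟩, rfl⟩
        · exact ⟨t + 1, ⟨by omega, le_rfl⟩, rfl⟩
    rw [hS, show t + 1 - s = t - s + 0 + 1 by omega]
    exact h

theorem ncard_vset {u v : V} {Q : G.Walk u v} (hQ : Q.IsPath) :
    (vset Q).ncard = Q.length + 1 := by
  classical
  have : vset Q = (Q.support.toFinset : Set V) := by ext; simp [vset]
  rw [this, Set.ncard_coe_finset, List.toFinset_card_of_nodup hQ.support_nodup,
    Walk.length_support]

theorem vset_finite {u v : V} (Q : G.Walk u v) : (vset Q).Finite :=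
  Q.support.finite_toSet

theorem IsHole.ncard_support {u : V} {c : G.Walk u u} (hc : IsHole c) :
    {x | x ∈ c.support}.ncard = c.length := by
  classical
  have : {x | x ∈ c.support} = (c.support.tail.toFinset : Set V) := by
    ext z
    simp only [Set.mem_ofPred_eq, List.coe_toFinset]
    constructor
    · intro h
      rcases (Walk.mem_support_iff c).1 h with rfl | h
      · exact c.end_mem_tail_support hc.1.not_nil
      · exact h
    · exact List.mem_of_mem_tail
  rw [this, Set.ncard_coe_finset, List.toFinset_card_of_nodup hc.1.support_nodup]
  simp

theorem IsHole.neighbors_eq {u : V} {c : G.Walk u u} (hc : IsHole c) {v y₁ y₂ z : V}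
    (hv : v ∈ c.support) (h₁ : y₁ ∈ c.support) (h₂ : y₂ ∈ c.support) (hz : z ∈ c.support)
    (ha₁ : G.Adj v y₁) (ha₂ : G.Adj v y₂) (haz : G.Adj v z) (hne : y₁ ≠ y₂) :
    z = y₁ ∨ z = y₂ := by
  have h2 := hc.1.ncard_neighborSet_toSubgraph_eq_two hv
  have hmem : ∀ y ∈ c.support, G.Adj v y → y ∈ c.toSubgraph.neighborSet v := by
    intro y hy hvy
    rw [Subgraph.mem_neighborSet, ← Subgraph.mem_edgeSet, Walk.mem_edges_toSubgraph]
    exact hc.2.2 v hv y hy hvy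
  have hfin : (c.toSubgraph.neighborSet v).Finite := Set.finite_of_ncard_ne_zero (by omega)
  have hsub : ({y₁, y₂} : Set V) ⊆ c.toSubgraph.neighborSet v := by
    rintro y (rfl | rfl)
    exacts [hmem _ h₁ ha₁, hmem _ h₂ ha₂]
  have heq := Set.eq_of_subset_of_ncard_le hsub (by rw [h2, Set.ncard_pair hne]) hfin
  have := hmem z hz haz
  rw [← heq] at this
  simpa using this

end InducedPaths

/-- The adjacencies in a long near-prism whose `i`-th constituent path has vertices
`p i 0, …, p i (n i)`. -/
structure PrismCoords {V : Type*} (G : SimpleGraph V) (ℓ : ℕ) (p : Fin 3 → ℕ → V)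
    (n : Fin 3 → ℕ) : Prop where
  adj_succ : ∀ i, ∀ s < n i, G.Adj (p i s) (p i (s + 1))
  adj_first : ∀ i j, i ≠ j → G.Adj (p i 0) (p j 0)
  adj_last : ∀ i j, i ≠ j → G.Adj (p i (n i)) (p j (n j))
  inj : ∀ i, ∀ s ≤ n i, ∀ t ≤ n i, p i s = p i t → s = t
  disj : ∀ i j, i ≠ j → ∀ s ≤ n i, ∀ t ≤ n j, p i s ≠ p j t
  adj_same : ∀ i, ∀ s ≤ n i, ∀ t ≤ n i, G.Adj (p i s) (p i t) → s + 1 = t ∨ t + 1 = s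
  adj_cross : ∀ i j, i ≠ j → ∀ s ≤ n i, ∀ t ≤ n j, G.Adj (p i s) (p j t) →
    (s = 0 ∧ t = 0) ∨ (s = n i ∧ t = n j)
  le_length : ∀ i j, i ≠ j → ℓ ≤ n i + n j + 2

section NearPrisms

variable {V : Type*} {G : SimpleGraph V} {ℓ : ℕ}

theorem disjoint_vset {u v u' v' : V} {Q : G.Walk u v} {R : G.Walk u' v'}
    (h : ∀ x, x ∈ Q.support → x ∉ R.support) : Disjoint (vset Q) (vset R) :=
  Set.disjoint_left.2 h

theorem mem_support_iff_getVert {u v y : V} (Q : G.Walk u v) :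
    y ∈ Q.support ↔ ∃ s ≤ Q.length, y = Q.getVert s := by
  rw [Walk.mem_support_iff_exists_getVert]
  constructor
  · rintro ⟨s, rfl, hs⟩; exact ⟨s, hs, rfl⟩
  · rintro ⟨s, hs, rfl⟩; exact ⟨s, rfl, hs⟩

theorem IsLongNearPrism.prismCoords {a b : Fin 3 → V} {P : ∀ i : Fin 3, G.Walk (a i) (b i)}
    (hℓ : 6 ≤ ℓ) (hP : IsLongNearPrism ℓ a b P) :
    PrismCoords G ℓ (fun i => (P i).getVert) (fun i => (P i).length) := by
  obtain ⟨ha, hb, -, hpath, hdisj, hhole⟩ := hP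
  have hinj : ∀ i, ∀ s ≤ (P i).length, ∀ t ≤ (P i).length,
      (P i).getVert s = (P i).getVert t → s = t :=
    fun i s hs t ht h => (hpath i).getVert_injOn hs ht h
  have hdis : ∀ i j, i ≠ j → ∀ s t, (P i).getVert s ≠ (P j).getVert t :=
    fun i j hij s t h => hdisj i j hij _ ((P i).getVert_mem_support s)
      (h ▸ (P j).getVert_mem_support t)
  have hlen : ∀ i j, i ≠ j → ℓ ≤ (P i).length + (P j).length + 2 := by
    intro i j hij
    obtain ⟨u, c, hc, hl, hS⟩ := hhole i j hij
    have h := hc.ncard_support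
    rw [hS, Set.ncard_union_eq (disjoint_vset (hdisj i j hij)) (vset_finite _)
      (vset_finite _), ncard_vset (hpath i), ncard_vset (hpath j)] at h
    omega
  have hnbr : ∀ i j, i ≠ j → ∀ s ≤ (P i).length, ∀ w ∈ vset (P i) ∪ vset (P j),
      G.Adj ((P i).getVert s) w →
      (0 < s ∧ w = (P i).getVert (s - 1)) ∨ (s = 0 ∧ w = (P j).getVert 0) ∨
      (s < (P i).length ∧ w = (P i).getVert (s + 1)) ∨
      (s = (P i).length ∧ w = (P j).getVert (P j).length) := by
    intro i j hij s hs w hw hadj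
    obtain ⟨u, c, hc, -, hS⟩ := hhole i j hij
    have hmem : ∀ z, z ∈ c.support ↔ z ∈ vset (P i) ∪ vset (P j) := fun z => by
      rw [← hS]; exact Iff.rfl
    have hi : ∀ t, (P i).getVert t ∈ c.support := fun t =>
      (hmem _).2 (Or.inl ((P i).getVert_mem_support t))
    have hj : ∀ t, (P j).getVert t ∈ c.support := fun t =>
      (hmem _).2 (Or.inr ((P j).getVert_mem_support t))
    have hw' := (hmem w).2 hw
    have hlij := hlen i j hij
    have hfirst : G.Adj ((P i).getVert 0) ((P j).getVert 0) := by simpa using ha i j hij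
    have hlast : G.Adj ((P i).getVert (P i).length) ((P j).getVert (P j).length) := by
      simpa using hb i j hij
    have hprev : 0 < s → G.Adj ((P i).getVert s) ((P i).getVert (s - 1)) := by
      intro h0
      have := (P i).adj_getVert_succ (i := s - 1) (by omega)
      rw [Nat.sub_add_cancel h0] at this
      exact this.symm
    rcases Nat.eq_zero_or_pos s with h0 | h0 <;> rcases Nat.lt_or_ge s (P i).length with h1 | h1
    · subst h0
      rcases hc.neighbors_eq (hi 0) (hj 0) (hi 1) hw' hfirst
        ((P i).adj_getVert_succ h1) hadj (hdis i j hij _ _).symm with h | h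
      · exact Or.inr (Or.inl ⟨rfl, h⟩)
      · exact Or.inr (Or.inr (Or.inl ⟨h1, h⟩))
    · have hs' : s = (P i).length := by omega
      have h0' : (P i).length = 0 := by omega
      rw [h0'] at hlast
      subst h0
      rcases hc.neighbors_eq (hi 0) (hj 0) (hj (P j).length) hw' hfirst hlast hadj
        (fun h => by have := hinj j _ (by omega) _ le_rfl h; omega) with h | h
      · exact Or.inr (Or.inl ⟨rfl, h⟩)
      · exact Or.inr (Or.inr (Or.inr ⟨hs', h⟩))
    · rcases hc.neighbors_eq (hi s) (hi (s - 1)) (hi (s + 1)) hw' (hprev h0)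
        ((P i).adj_getVert_succ h1) hadj
        (fun h => by have := hinj i _ (by omega) _ (by omega) h; omega) with h | h
      · exact Or.inl ⟨h0, h⟩
      · exact Or.inr (Or.inr (Or.inl ⟨h1, h⟩))
    · have hs' : s = (P i).length := by omega
      rw [← hs'] at hlast
      rcases hc.neighbors_eq (hi s) (hi (s - 1)) (hj (P j).length) hw' (hprev h0)
        hlast hadj (hdis i j hij _ _) with h | h
      · exact Or.inl ⟨h0, h⟩
      · exact Or.inr (Or.inr (Or.inr ⟨hs', h⟩))
  refine ⟨fun i s hs => (P i).adj_getVert_succ hs, ?_, ?_, hinj,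
    fun i j hij s _ t _ => hdis i j hij s t, ?_, ?_, hlen⟩
  · simpa using ha
  · simpa using hb
  · intro i s hs t ht hadj
    obtain ⟨j, hij⟩ := exists_ne i
    rcases hnbr i j hij.symm s hs _ (Or.inl ((P i).getVert_mem_support t)) hadj with
      ⟨h, h'⟩ | ⟨h, h'⟩ | ⟨h, h'⟩ | ⟨h, h'⟩
    · have := hinj i _ ht _ (by omega) h'; omega
    · exact absurd h' (hdis i j hij.symm _ _)
    · have := hinj i _ ht _ (by omega) h'; omega
    · exact absurd h' (hdis i j hij.symm _ _)
  · intro i j hij s hs t ht hadj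
    rcases hnbr i j hij s hs _ (Or.inr ((P j).getVert_mem_support t)) hadj with
      ⟨h, h'⟩ | ⟨h, h'⟩ | ⟨h, h'⟩ | ⟨h, h'⟩
    · exact absurd h'.symm (hdis i j hij _ _)
    · exact Or.inl ⟨h, hinj j _ ht _ (by omega) h'⟩
    · exact absurd h'.symm (hdis i j hij _ _)
    · exact Or.inr ⟨h, hinj j _ ht _ le_rfl h'⟩

theorem ncard_prismSupport {a b : Fin 3 → V} {P : ∀ i : Fin 3, G.Walk (a i) (b i)}
    (hpath : ∀ i, (P i).IsPath)
    (hdisj : ∀ i j, i ≠ j → ∀ x, x ∈ (P i).support → x ∉ (P j).support) :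
    (prismSupport P).ncard = (P 0).length + (P 1).length + (P 2).length + 3 := by
  have h : prismSupport P = (vset (P 0) ∪ vset (P 1)) ∪ vset (P 2) := by
    ext z
    simp [prismSupport, Fin.exists_fin_succ, or_assoc]
  rw [h, Set.ncard_union_eq _ ((vset_finite _).union (vset_finite _)) (vset_finite _),
    Set.ncard_union_eq (disjoint_vset (hdisj 0 1 (by decide))) (vset_finite _)
    (vset_finite _), ncard_vset (hpath 0), ncard_vset (hpath 1), ncard_vset (hpath 2)]
  · omega
  · rw [Set.disjoint_left]
    rintro z (hz | hz)
    exacts [hdisj 0 2 (by decide) z hz, hdisj 1 2 (by decide) z hz]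

/-- The vertex sets `S` and `T` of two constituent paths of a near-prism are disjoint, and the
only edges between them join `u` to `u'` and `v` to `v'`. -/
def OnlyEndEdges (G : SimpleGraph V) (u v : V) (S : Set V) (u' v' : V) (T : Set V) : Prop :=
  ∀ x ∈ S, ∀ y ∈ T, x ≠ y ∧ (G.Adj x y → (x = u ∧ y = u') ∨ (x = v ∧ y = v'))

theorem OnlyEndEdges.symm {u v u' v' : V} {S T : Set V}
    (h : OnlyEndEdges G u v S u' v' T) : OnlyEndEdges G u' v' T u v S := by
  intro x hx y hy
  obtain ⟨h1, h2⟩ := h y hy x hx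
  exact ⟨h1.symm, fun hxy => (h2 hxy.symm).imp And.symm And.symm⟩

theorem ShortestLNP.length_le {a b : Fin 3 → V} {P : ∀ i : Fin 3, G.Walk (a i) (b i)}
    (hℓ : 6 ≤ ℓ) (hsh : ShortestLNP G ℓ P) {a₀ a₁ a₂ b₀ b₁ b₂ : V} {S₀ S₁ S₂ : Set V}
    {n₀ n₁ n₂ : ℕ}
    (h₀ : IndPathOn G a₀ b₀ S₀ n₀) (h₁ : IndPathOn G a₁ b₁ S₁ n₁)
    (h₂ : IndPathOn G a₂ b₂ S₂ n₂)
    (ha₀₁ : G.Adj a₀ a₁) (ha₀₂ : G.Adj a₀ a₂) (ha₁₂ : G.Adj a₁ a₂)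
    (hb₀₁ : G.Adj b₀ b₁) (hb₀₂ : G.Adj b₀ b₂) (hb₁₂ : G.Adj b₁ b₂)
    (he₀₁ : OnlyEndEdges G a₀ b₀ S₀ a₁ b₁ S₁) (he₀₂ : OnlyEndEdges G a₀ b₀ S₀ a₂ b₂ S₂)
    (he₁₂ : OnlyEndEdges G a₁ b₁ S₁ a₂ b₂ S₂)
    (hl₀₁ : ℓ ≤ n₀ + n₁ + 2) (hl₀₂ : ℓ ≤ n₀ + n₂ + 2) (hl₁₂ : ℓ ≤ n₁ + n₂ + 2) :
    (P 0).length + (P 1).length + (P 2).length ≤ n₀ + n₁ + n₂ := by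
  have hQ : ∀ i : Fin 3, IndPathOn G (![a₀, a₁, a₂] i) (![b₀, b₁, b₂] i)
      (![S₀, S₁, S₂] i) (![n₀, n₁, n₂] i) := by
    intro i; fin_cases i
    exacts [h₀, h₁, h₂]
  have hedge : ∀ i j : Fin 3, i ≠ j → OnlyEndEdges G (![a₀, a₁, a₂] i) (![b₀, b₁, b₂] i)
      (![S₀, S₁, S₂] i) (![a₀, a₁, a₂] j) (![b₀, b₁, b₂] j) (![S₀, S₁, S₂] j) := by
    intro i j hij
    fin_cases i <;> fin_cases j
    exacts [absurd rfl hij, he₀₁, he₀₂, he₀₁.symm, absurd rfl hij, he₁₂, he₀₂.symm, he₁₂.symm,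
      absurd rfl hij]
  have hA : ∀ i j : Fin 3, i ≠ j → G.Adj (![a₀, a₁, a₂] i) (![a₀, a₁, a₂] j) := by
    intro i j hij
    fin_cases i <;> fin_cases j
    exacts [absurd rfl hij, ha₀₁, ha₀₂, ha₀₁.symm, absurd rfl hij, ha₁₂, ha₀₂.symm, ha₁₂.symm,
      absurd rfl hij]
  have hB : ∀ i j : Fin 3, i ≠ j → G.Adj (![b₀, b₁, b₂] i) (![b₀, b₁, b₂] j) := by
    intro i j hij
    fin_cases i <;> fin_cases j
    exacts [absurd rfl hij, hb₀₁, hb₀₂, hb₀₁.symm, absurd rfl hij, hb₁₂, hb₀₂.symm, hb₁₂.symm,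
      absurd rfl hij]
  have hL : ∀ i j : Fin 3, i ≠ j → ℓ ≤ ![n₀, n₁, n₂] i + ![n₀, n₁, n₂] j + 2 := by
    intro i j hij
    fin_cases i <;> fin_cases j <;> simp at hij ⊢ <;> omega
  have hQ' := hQ
  choose Q hind hset hlen using hQ'
  have hdisj : ∀ i j, i ≠ j → ∀ x, x ∈ (Q i).support → x ∉ (Q j).support := by
    intro i j hij x hx hx'
    exact (hedge i j hij x (by rw [← hset i]; exact hx) x (by rw [← hset j]; exact hx')).1 rfl
  have hnp : IsLongNearPrism ℓ ![a₀, a₁, a₂] ![b₀, b₁, b₂] Q := by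
    refine ⟨hA, hB, ?_, fun i => (hind i).1, hdisj, ?_⟩
    · have hends : ∀ i j, ![a₀, a₁, a₂] i = ![b₀, b₁, b₂] j → i = j ∧ ![n₀, n₁, n₂] i = 0 := by
        intro i j h
        have hij : i = j := by
          by_contra hij
          exact hdisj i j hij _ (Q i).start_mem_support (by rw [h]; exact (Q j).end_mem_support)
        subst hij
        refine ⟨rfl, ?_⟩
        rw [← hlen i]
        have h1 : ∀ {u v : V} (R : G.Walk u v), R.IsPath → u = v → R.length = 0 := by
          rintro u v R hR rfl
          exact Walk.length_eq_zero_iff.2 (Walk.isPath_iff_nil.1 hR)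
        exact h1 (Q i) (hind i).1 h
      rintro x ⟨⟨i, rfl⟩, i', hi⟩ y ⟨⟨j, rfl⟩, j', hj⟩
      obtain ⟨-, hi⟩ := hends i i' hi.symm
      obtain ⟨-, hj⟩ := hends j j' hj.symm
      by_contra hne
      have := hL i j (fun h => hne (h ▸ rfl))
      omega
    · intro i j hij
      rw [hset i, hset j]
      exact (hQ i).isLongHoleOn (hQ j) (hA i j hij) (hB i j hij)
        (fun x hx y hy => (hedge i j hij x hx y hy).1)
        (fun x hx y hy => (hedge i j hij x hx y hy).2) (by omega) (hL i j hij)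
  have h := hsh.2 _ _ Q hnp
  rw [ncard_prismSupport hsh.1.2.2.2.1 hsh.1.2.2.2.2.1,
    ncard_prismSupport (fun i => (hind i).1) hdisj, hlen 0, hlen 1, hlen 2] at h
  simpa using h

theorem Tidy.index_bounds {a b : Fin 3 → V} {P : ∀ i : Fin 3, G.Walk (a i) (b i)}
    (htidy : Tidy G ℓ P) {x : V} (hx : x ∉ prismSupport P) {i : Fin 3} {s : ℕ}
    (hs : s ≤ (P i).length) (hadj : G.Adj x ((P i).getVert s)) :
    ℓ ≤ (P i).length ∧ ℓ / 2 - 1 ≤ s ∧ s + (ℓ / 2 - 1) ≤ (P i).length := by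
  have hnot : (P i).getVert s ∉ frameStar ℓ P := fun h => (htidy.2 h hx).2 hadj.symm
  simp only [frameStar, Set.mem_iUnion, not_exists] at hnot
  have h := hnot i
  split_ifs at h with hl
  · exact absurd ((P i).getVert_mem_support s) h
  · rw [Set.mem_union, not_or] at h
    refine ⟨by omega, ?_, ?_⟩
    · by_contra hlt
      apply h.1
      simp only [Set.mem_ofPred_eq]
      rw [List.mem_take_iff_getElem]
      refine ⟨s, by simp; omega, ?_⟩
      rw [Walk.support_getElem_eq_getVert]
    · by_contra hlt
      apply h.2
      simp only [Set.mem_ofPred_eq]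
      rw [List.mem_take_iff_getElem]
      refine ⟨(P i).length - s, by simp; omega, ?_⟩
      rw [List.getElem_reverse, Walk.support_getElem_eq_getVert]
      congr 1
      simp
      omega

section Coordinates

variable {p : Fin 3 → ℕ → V} {n : Fin 3 → ℕ} {x : V} {i j k : Fin 3}

theorem PrismCoords.segment (hc : PrismCoords G ℓ p n) (i : Fin 3) {s t : ℕ} (hst : s ≤ t)
    (ht : t ≤ n i) : IndPathOn G (p i s) (p i t) (p i '' Set.Icc s t) (t - s) :=
  indPathOn_image_Icc (hc.adj_succ i) (hc.inj i) (hc.adj_same i) hst ht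

theorem PrismCoords.onlyEndEdges (hc : PrismCoords G ℓ p n) (hij : i ≠ j) :
    OnlyEndEdges G (p i 0) (p i (n i)) (p i '' Set.Icc 0 (n i))
      (p j 0) (p j (n j)) (p j '' Set.Icc 0 (n j)) := by
  rintro _ ⟨s, ⟨-, hs⟩, rfl⟩ _ ⟨t, ⟨-, ht⟩, rfl⟩
  refine ⟨hc.disj i j hij s hs t ht, fun hadj => ?_⟩
  rcases hc.adj_cross i j hij s hs t ht hadj with ⟨rfl, rfl⟩ | ⟨rfl, rfl⟩
  exacts [Or.inl ⟨rfl, rfl⟩, Or.inr ⟨rfl, rfl⟩]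

theorem ShortestLNP.not_neighbors_spread_on_one_path {a b : Fin 3 → V}
    {P : ∀ i : Fin 3, G.Walk (a i) (b i)} (hℓ : 6 ≤ ℓ) (hsh : ShortestLNP G ℓ P)
    (hc : PrismCoords G ℓ p n)
    (hN : (P 0).length + (P 1).length + (P 2).length = n i + n j + n k)
    (hij : i ≠ j) (hik : i ≠ k) (hjk : j ≠ k)
    (hoff : ∀ i, ∀ s ≤ n i, x ≠ p i s) {s t : ℕ} (hst : s + 3 ≤ t) (ht : t ≤ n i)
    (hxs : G.Adj x (p i s)) (hxt : G.Adj x (p i t))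
    (hbetween : ∀ r ≤ n i, G.Adj x (p i r) → s ≤ r ∧ r ≤ t)
    (hj : ∀ r ≤ n j, ¬ G.Adj x (p j r)) (hk : ∀ r ≤ n k, ¬ G.Adj x (p k r))
    (hlen : ℓ ≤ s + (n i - t) + 2) : False := by
  have hsx := (hc.segment i (Nat.zero_le s) (by omega)).join (IndPathOn.single x) hxs.symm
    (by
      rintro _ ⟨r, ⟨-, hr⟩, rfl⟩ _ rfl
      exact (hoff i r (by omega)).symm)
    (by
      rintro _ ⟨r, ⟨-, hr⟩, rfl⟩ _ rfl hadj
      have := hbetween r (by omega) hadj.symm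
      obtain rfl : r = s := by omega
      exact ⟨rfl, rfl⟩)
  have hnew := hsx.join (hc.segment i ht le_rfl) hxt
    (by
      rintro _ (⟨r, ⟨-, hr⟩, rfl⟩ | rfl) _ ⟨r', ⟨hr', hr''⟩, rfl⟩
      · intro h
        have := hc.inj i r (by omega) r' hr'' h
        omega
      · exact hoff i r' hr'')
    (by
      rintro _ (⟨r, ⟨-, hr⟩, rfl⟩ | rfl) _ ⟨r', ⟨hr', hr''⟩, rfl⟩ hadj
      · have := hc.adj_same i r (by omega) r' hr'' hadj
        omega
      · have := hbetween r' hr'' hadj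
        obtain rfl : r' = t := by omega
        exact ⟨rfl, rfl⟩)
  have hcross : ∀ m, i ≠ m → (∀ r ≤ n m, ¬ G.Adj x (p m r)) →
      OnlyEndEdges G (p i 0) (p i (n i)) (p i '' Set.Icc 0 s ∪ {x} ∪ p i '' Set.Icc t (n i))
        (p m 0) (p m (n m)) (p m '' Set.Icc 0 (n m)) := by
    rintro m him hm y ((⟨r, ⟨-, hr⟩, rfl⟩ | rfl) | ⟨r, ⟨-, hr⟩, rfl⟩) z hz
    · exact hc.onlyEndEdges him _ ⟨r, ⟨Nat.zero_le r, by omega⟩, rfl⟩ z hz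
    · obtain ⟨r, ⟨-, hr⟩, rfl⟩ := hz
      exact ⟨hoff m r hr, fun h => absurd h (hm r hr)⟩
    · exact hc.onlyEndEdges him _ ⟨r, ⟨Nat.zero_le r, by omega⟩, rfl⟩ z hz
  have h := hsh.length_le hℓ hnew (hc.segment j (Nat.zero_le _) le_rfl)
    (hc.segment k (Nat.zero_le _) le_rfl)
    (hc.adj_first i j hij) (hc.adj_first i k hik) (hc.adj_first j k hjk)
    (hc.adj_last i j hij) (hc.adj_last i k hik) (hc.adj_last j k hjk)
    (hcross j hij hj) (hcross k hik hk) (hc.onlyEndEdges hjk)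
    (by omega) (by omega) (by have := hc.le_length j k hjk; omega)
  omega

theorem ShortestLNP.not_adjacent_neighbors_on_path {a b : Fin 3 → V}
    {P : ∀ i : Fin 3, G.Walk (a i) (b i)} (hℓ : 6 ≤ ℓ) (hsh : ShortestLNP G ℓ P)
    (hc : PrismCoords G ℓ p n)
    (hN : (P 0).length + (P 1).length + (P 2).length = n i + n j + n k)
    (hij : i ≠ j) (hik : i ≠ k) (hjk : j ≠ k)
    (hoff : ∀ i, ∀ s ≤ n i, x ≠ p i s) {s r : ℕ} (hs : s + 2 ≤ n i) (hr : r + 2 ≤ n j)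
    (hxs : G.Adj x (p i s)) (hxr : G.Adj x (p j r)) (hxr' : G.Adj x (p j (r + 1)))
    (hfirst : ∀ t ≤ n i, G.Adj x (p i t) → s ≤ t)
    (hj : ∀ t ≤ n j, G.Adj x (p j t) → t = r ∨ t = r + 1)
    (hk : ∀ t ≤ n k, ¬ G.Adj x (p k t))
    (hlen : ℓ ≤ s + r + 3) (hlen' : ℓ ≤ s + (n j - r) + 3) : False := by
  have h₀ := (hc.segment i (Nat.zero_le s) (by omega)).join (IndPathOn.single x) hxs.symm
    (by
      rintro _ ⟨t, ⟨-, ht⟩, rfl⟩ _ rfl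
      exact (hoff i t (by omega)).symm)
    (by
      rintro _ ⟨t, ⟨-, ht⟩, rfl⟩ _ rfl hadj
      have := hfirst t (by omega) hadj.symm
      obtain rfl : t = s := by omega
      exact ⟨rfl, rfl⟩)
  have h₁ := hc.segment j (Nat.zero_le r) (by omega)
  have h₂ := (hc.segment k (Nat.zero_le _) le_rfl).join
    (hc.segment j (s := r + 1) (by omega) le_rfl).reverse (hc.adj_last k j hjk.symm)
    (by
      rintro _ ⟨t, ⟨-, ht⟩, rfl⟩ _ ⟨t', ⟨-, ht'⟩, rfl⟩
      exact hc.disj k j hjk.symm t ht t' ht')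
    (by
      rintro _ ⟨t, ⟨-, ht⟩, rfl⟩ _ ⟨t', ⟨hrt, ht'⟩, rfl⟩ hadj
      rcases hc.adj_cross k j hjk.symm t ht t' ht' hadj with ⟨-, h⟩ | ⟨rfl, rfl⟩
      · omega
      · exact ⟨rfl, rfl⟩)
  have h := hsh.length_le hℓ h₀ h₁ h₂
    (hc.adj_first i j hij) (hc.adj_first i k hik) (hc.adj_first j k hjk)
    hxr hxr' (hc.adj_succ j r (by omega))
    (by
      rintro _ (⟨t, ⟨-, ht⟩, rfl⟩ | rfl) _ ⟨t', ⟨-, ht'⟩, rfl⟩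
      · refine ⟨hc.disj i j hij t (by omega) t' (by omega), fun hadj => ?_⟩
        rcases hc.adj_cross i j hij t (by omega) t' (by omega) hadj with ⟨rfl, rfl⟩ | ⟨h, -⟩
        · exact Or.inl ⟨rfl, rfl⟩
        · omega
      · refine ⟨hoff j t' (by omega), fun hadj => ?_⟩
        have := hj t' (by omega) hadj
        obtain rfl : t' = r := by omega
        exact Or.inr ⟨rfl, rfl⟩)
    (by
      rintro _ (⟨t, ⟨-, ht⟩, rfl⟩ | rfl) _ (⟨t', ⟨-, ht'⟩, rfl⟩ | ⟨t', ⟨hrt, ht'⟩, rfl⟩)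
      · refine ⟨hc.disj i k hik t (by omega) t' ht', fun hadj => ?_⟩
        rcases hc.adj_cross i k hik t (by omega) t' ht' hadj with ⟨rfl, rfl⟩ | ⟨h, -⟩
        · exact Or.inl ⟨rfl, rfl⟩
        · omega
      · refine ⟨hc.disj i j hij t (by omega) t' ht', fun hadj => ?_⟩
        have := hc.adj_cross i j hij t (by omega) t' ht' hadj
        omega
      · exact ⟨hoff k t' ht', fun hadj => absurd hadj (hk t' ht')⟩
      · refine ⟨hoff j t' ht', fun hadj => ?_⟩
        have := hj t' ht' hadj
        obtain rfl : t' = r + 1 := by omega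
        exact Or.inr ⟨rfl, rfl⟩)
    (by
      rintro _ ⟨t, ⟨-, ht⟩, rfl⟩ _ (⟨t', ⟨-, ht'⟩, rfl⟩ | ⟨t', ⟨hrt, ht'⟩, rfl⟩)
      · refine ⟨hc.disj j k hjk t (by omega) t' ht', fun hadj => ?_⟩
        rcases hc.adj_cross j k hjk t (by omega) t' ht' hadj with ⟨rfl, rfl⟩ | ⟨h, -⟩
        · exact Or.inl ⟨rfl, rfl⟩
        · omega
      · refine ⟨fun h => ?_, fun hadj => ?_⟩
        · have := hc.inj j t (by omega) t' ht' h
          omega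
        · have := hc.adj_same j t (by omega) t' ht' hadj
          obtain rfl : t = r := by omega
          obtain rfl : t' = t + 1 := by omega
          exact Or.inr ⟨rfl, rfl⟩)
    (by omega) (by omega) (by have := hc.le_length j k hjk; omega)
  omega

theorem PrismCoords.hasLongTheta (hc : PrismCoords G ℓ p n) (hij : i ≠ j)
    (hoff : ∀ i, ∀ s ≤ n i, x ≠ p i s) {s t : ℕ} (hs0 : 0 < s) (hs : s < n i) (ht0 : 0 < t)
    (ht : t < n j) (hxs : G.Adj x (p i s)) (hxt : G.Adj x (p j t))
    (hi : ∀ r ≤ n i, G.Adj x (p i r) → r = s) (hj : ∀ r ≤ n j, G.Adj x (p j r) → r = t)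
    (hlen : ℓ ≤ s + t + 3) (hlen' : ℓ ≤ (n i - s) + (n j - t) + 3) : HasLongTheta G ℓ := by
  have hne := hc.disj i j hij s hs.le t ht.le
  have hnadj : ¬ G.Adj (p i s) (p j t) := fun h => by
    have := hc.adj_cross i j hij s hs.le t ht.le h
    omega
  have h₁ := ((IndPathOn.single (p i s)).join (IndPathOn.single x) hxs.symm
    (by rintro _ rfl _ rfl; exact (hoff i s hs.le).symm)
    (by rintro _ rfl _ rfl _; exact ⟨rfl, rfl⟩)).join (IndPathOn.single (p j t)) hxt
    (by
      rintro _ (rfl | rfl) _ rfl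
      exacts [hne, hoff j t ht.le])
    (by
      rintro _ (rfl | rfl) _ rfl h
      exacts [absurd h hnadj, ⟨rfl, rfl⟩])
  have h₂ := (hc.segment i (Nat.zero_le s) hs.le).reverse.join
    (hc.segment j (Nat.zero_le t) ht.le) (hc.adj_first i j hij)
    (by
      rintro _ ⟨r, ⟨-, hr⟩, rfl⟩ _ ⟨r', ⟨-, hr'⟩, rfl⟩
      exact hc.disj i j hij r (by omega) r' (by omega))
    (by
      rintro _ ⟨r, ⟨-, hr⟩, rfl⟩ _ ⟨r', ⟨-, hr'⟩, rfl⟩ h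
      rcases hc.adj_cross i j hij r (by omega) r' (by omega) h with ⟨rfl, rfl⟩ | ⟨h, -⟩
      · exact ⟨rfl, rfl⟩
      · omega)
  have h₃ := (hc.segment i hs.le le_rfl).join
    (hc.segment j ht.le le_rfl).reverse (hc.adj_last i j hij)
    (by
      rintro _ ⟨r, ⟨-, hr⟩, rfl⟩ _ ⟨r', ⟨-, hr'⟩, rfl⟩
      exact hc.disj i j hij r hr r' hr')
    (by
      rintro _ ⟨r, ⟨hsr, hr⟩, rfl⟩ _ ⟨r', ⟨-, hr'⟩, rfl⟩ h
      rcases hc.adj_cross i j hij r hr r' hr' h with ⟨h, -⟩ | ⟨rfl, rfl⟩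
      · omega
      · exact ⟨rfl, rfl⟩)
  obtain ⟨Q₁, hQ₁, hS₁, hl₁⟩ := h₁
  obtain ⟨Q₂, hQ₂, hS₂, hl₂⟩ := h₂
  obtain ⟨Q₃, hQ₃, hS₃, hl₃⟩ := h₃
  have hi₁ : ∀ z ∈ inter Q₁, z = x := by
    rintro z ⟨hz, hzu, hzv⟩
    have : z ∈ vset Q₁ := hz
    rw [hS₁] at this
    rcases this with (h | h) | h
    exacts [absurd h hzu, h, absurd h hzv]
  have hi₂ : ∀ z ∈ inter Q₂, (∃ r < s, z = p i r) ∨ ∃ r < t, z = p j r := by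
    rintro z ⟨hz, hzu, hzv⟩
    have : z ∈ vset Q₂ := hz
    rw [hS₂] at this
    rcases this with ⟨r, ⟨-, hr⟩, rfl⟩ | ⟨r, ⟨-, hr⟩, rfl⟩
    · exact Or.inl ⟨r, lt_of_le_of_ne hr (fun h => hzu (h ▸ rfl)), rfl⟩
    · exact Or.inr ⟨r, lt_of_le_of_ne hr (fun h => hzv (h ▸ rfl)), rfl⟩
  have hi₃ : ∀ z ∈ inter Q₃, (∃ r, s < r ∧ r ≤ n i ∧ z = p i r) ∨
      ∃ r, t < r ∧ r ≤ n j ∧ z = p j r := by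
    rintro z ⟨hz, hzu, hzv⟩
    have : z ∈ vset Q₃ := hz
    rw [hS₃] at this
    rcases this with ⟨r, ⟨hr, hr'⟩, rfl⟩ | ⟨r, ⟨hr, hr'⟩, rfl⟩
    · exact Or.inl ⟨r, lt_of_le_of_ne hr (fun h => hzu (h ▸ rfl)), hr', rfl⟩
    · exact Or.inr ⟨r, lt_of_le_of_ne hr (fun h => hzv (h ▸ rfl)), hr', rfl⟩
  refine ⟨p i s, p j t, Q₁, Q₂, Q₃, hne, hnadj, hQ₁, hQ₂, hQ₃, ?_, ?_, ?_, by omega, by omega,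
    by have := hc.le_length i j hij; omega⟩
  · intro y hy z hz
    obtain rfl := hi₁ y hy
    rcases hi₂ z hz with ⟨r, hr, rfl⟩ | ⟨r, hr, rfl⟩
    · exact ⟨hoff i r (by omega), fun h => by have := hi r (by omega) h; omega⟩
    · exact ⟨hoff j r (by omega), fun h => by have := hj r (by omega) h; omega⟩
  · intro y hy z hz
    obtain rfl := hi₁ y hy
    rcases hi₃ z hz with ⟨r, hr, hr', rfl⟩ | ⟨r, hr, hr', rfl⟩
    · exact ⟨hoff i r hr', fun h => by have := hi r hr' h; omega⟩
    · exact ⟨hoff j r hr', fun h => by have := hj r hr' h; omega⟩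
  · intro y hy z hz
    rcases hi₂ y hy with ⟨r, hr, rfl⟩ | ⟨r, hr, rfl⟩ <;>
      rcases hi₃ z hz with ⟨r', hr', hr'', rfl⟩ | ⟨r', hr', hr'', rfl⟩
    · exact ⟨fun h => by have := hc.inj i r (by omega) r' hr'' h; omega,
        fun h => by have := hc.adj_same i r (by omega) r' hr'' h; omega⟩
    · exact ⟨hc.disj i j hij r (by omega) r' hr'',
        fun h => by have := hc.adj_cross i j hij r (by omega) r' hr'' h; omega⟩
    · exact ⟨hc.disj j i hij.symm r (by omega) r' hr'',
        fun h => by have := hc.adj_cross j i hij.symm r (by omega) r' hr'' h; omega⟩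
    · exact ⟨fun h => by have := hc.inj j r (by omega) r' hr'' h; omega,
        fun h => by have := hc.adj_same j r (by omega) r' hr'' h; omega⟩

end Coordinates

theorem prismGraph_le {a b : Fin 3 → V} {P : ∀ i : Fin 3, G.Walk (a i) (b i)}
    (ha : ∀ i j, i ≠ j → G.Adj (a i) (a j)) (hb : ∀ i j, i ≠ j → G.Adj (b i) (b j)) :
    prismGraph G a b P ≤ G := by
  intro u v h
  simp only [prismGraph, fromEdgeSet_adj] at h
  rcases h with ⟨(⟨i, j, hij, he⟩ | ⟨i, j, hij, he⟩) | ⟨i, he⟩, -⟩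
  · rw [← mem_edgeSet, he]; exact ha i j hij
  · rw [← mem_edgeSet, he]; exact hb i j hij
  · exact (P i).adj_of_mem_edges he

theorem KMajor.exists_neighbor {a b : Fin 3 → V} {P : ∀ i : Fin 3, G.Walk (a i) (b i)}
    {x : V} (hx : KMajor G P x) : ∃ i, ∃ s ≤ (P i).length, G.Adj x ((P i).getVert s) := by
  by_contra hno
  push Not at hno
  refine hx.2 ⟨a 0, a 0, Walk.nil, Walk.IsPath.nil, by simp, fun z hz hadj => ?_⟩
  obtain ⟨i, hi⟩ := Set.mem_iUnion.1 hz
  obtain ⟨s, hs, rfl⟩ := (mem_support_iff_getVert _).1 hi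
  exact absurd hadj (hno i s hs)

theorem KMajor.lt_of_neighbors_on_one_path {a b : Fin 3 → V}
    {P : ∀ i : Fin 3, G.Walk (a i) (b i)} {x : V} (hx : KMajor G P x)
    (ha : ∀ i j, i ≠ j → G.Adj (a i) (a j)) (hb : ∀ i j, i ≠ j → G.Adj (b i) (b j))
    (hc : PrismCoords G ℓ (fun i => (P i).getVert) (fun i => (P i).length))
    {i : Fin 3} {s t : ℕ} (hst : s ≤ t) (ht : t ≤ (P i).length)
    (hnbr : ∀ j, ∀ r ≤ (P j).length, G.Adj x ((P j).getVert r) → j = i ∧ s ≤ r ∧ r ≤ t) :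
    s + 3 ≤ t := by
  by_contra hlt
  have hseg := indPathOn_image_Icc (G := prismGraph G a b P) (f := (P i).getVert)
    (N := (P i).length)
    (fun r hr => by
      simp only [prismGraph, fromEdgeSet_adj]
      refine ⟨Or.inr ⟨i, ?_⟩, ((P i).adj_getVert_succ hr).ne⟩
      rw [Walk.mk_mem_edges_iff_exists]
      exact ⟨r, hr, rfl⟩)
    (hc.inj i)
    (fun r hr r' hr' h => hc.adj_same i r hr r' hr' (prismGraph_le ha hb h)) hst ht
  obtain ⟨W, ⟨hW, -⟩, hS, hl⟩ := hseg
  refine hx.2 ⟨_, _, W, hW, by omega, fun z hz hadj => ?_⟩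
  obtain ⟨j, hj⟩ := Set.mem_iUnion.1 hz
  obtain ⟨r, hr, rfl⟩ := (mem_support_iff_getVert _).1 hj
  obtain ⟨rfl, h1, h2⟩ := hnbr j r hr hadj
  have : (P j).getVert r ∈ vset W := by
    rw [hS]
    exact ⟨r, ⟨h1, h2⟩, rfl⟩
  exact this

end NearPrisms

theorem sum_fin_three_eq (f : Fin 3 → ℕ) {i j k : Fin 3} (hij : i ≠ j) (hik : i ≠ k)
    (hjk : j ≠ k) : f 0 + f 1 + f 2 = f i + f j + f k := by
  fin_cases i <;> fin_cases j <;> fin_cases k <;> simp at hij hik hjk ⊢ <;> omega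

theorem exists_other_two (i : Fin 3) : ∃ j k : Fin 3, i ≠ j ∧ i ≠ k ∧ j ≠ k := by
  revert i; decide

theorem exists_third {i j : Fin 3} (hij : i ≠ j) : ∃ k, i ≠ k ∧ j ≠ k := by
  revert i j; decide

end LEH

/-- in a graph with no long theta, a `K`-major vertex has three pairwise
nonadjacent neighbours in `V(K)`, for a tidy shortest long near-prism `K`. -/
theorem three_pairwise_nonadjacent {V : Type*} [Fintype V]
    (ℓ : ℕ) (hℓ : 6 ≤ ℓ) (hℓeven : Even ℓ)
    (G : SimpleGraph V) (hnt : ¬ HasLongTheta G ℓ)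
    {a b : Fin 3 → V} (P : ∀ i : Fin 3, G.Walk (a i) (b i))
    (hsh : ShortestLNP G ℓ P) (htidy : Tidy G ℓ P)
    (x : V) (hx : KMajor G P x) :
    ∃ y₁ y₂ y₃, y₁ ∈ prismSupport P ∧ y₂ ∈ prismSupport P ∧ y₃ ∈ prismSupport P ∧
      G.Adj x y₁ ∧ G.Adj x y₂ ∧ G.Adj x y₃ ∧
      y₁ ≠ y₂ ∧ y₁ ≠ y₃ ∧ y₂ ≠ y₃ ∧
      ¬ G.Adj y₁ y₂ ∧ ¬ G.Adj y₁ y₃ ∧ ¬ G.Adj y₂ y₃ := by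
  classical
  by_contra hno
  have hP := hsh.1
  obtain ⟨ha, hb, -⟩ := id hP
  have hc := hP.prismCoords hℓ
  set p : Fin 3 → ℕ → V := fun i => (P i).getVert
  set n : Fin 3 → ℕ := fun i => (P i).length
  have hmem : ∀ i s, p i s ∈ prismSupport P := fun i s =>
    Set.mem_iUnion.2 ⟨i, (P i).getVert_mem_support s⟩
  have hoff : ∀ i, ∀ s ≤ n i, x ≠ p i s := fun i s _ h => hx.1 (h ▸ hmem i s)
  have hbd : ∀ i, ∀ s ≤ n i, G.Adj x (p i s) →
      ℓ ≤ n i ∧ ℓ / 2 - 1 ≤ s ∧ s + (ℓ / 2 - 1) ≤ n i :=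
    fun i s hs h => htidy.index_bounds hx.1 hs h
  have hsum : ∀ {i j k : Fin 3}, i ≠ j → i ≠ k → j ≠ k →
      (P 0).length + (P 1).length + (P 2).length = n i + n j + n k :=
    fun hij hik hjk => sum_fin_three_eq n hij hik hjk
  obtain ⟨m, hm⟩ := hℓeven
  have hcross : ∀ i j, i ≠ j → ∀ s ≤ n i, ∀ t ≤ n j, G.Adj x (p i s) → G.Adj x (p j t) →
      ¬ G.Adj (p i s) (p j t) := by
    intro i j hij s hs t ht hxs hxt h
    have h1 := hc.adj_cross i j hij s hs t ht h
    have h2 := hbd i s hs hxs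
    have h3 := hbd j t ht hxt
    omega
  obtain ⟨i, s₀, hs₀, hxs₀⟩ : ∃ i, ∃ s ≤ n i, G.Adj x (p i s) := hx.exists_neighbor
  by_cases hone : ∀ j, ∀ t ≤ n j, G.Adj x (p j t) → j = i
  · obtain ⟨j, k, hij, hik, hjk⟩ := exists_other_two i
    have hex : ∃ s, s ≤ n i ∧ G.Adj x (p i s) := ⟨s₀, hs₀, hxs₀⟩
    obtain ⟨s, ⟨hs, hxs⟩, hsmin⟩ :
        ∃ s, (s ≤ n i ∧ G.Adj x (p i s)) ∧ ∀ r ≤ n i, G.Adj x (p i r) → s ≤ r :=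
      ⟨Nat.find hex, Nat.find_spec hex, fun r hr h => Nat.find_min' hex ⟨hr, h⟩⟩
    obtain ⟨t, ⟨ht, hxt⟩, htmax⟩ :
        ∃ t, (t ≤ n i ∧ G.Adj x (p i t)) ∧ ∀ r ≤ n i, G.Adj x (p i r) → r ≤ t :=
      ⟨Nat.findGreatest (fun t => G.Adj x (p i t)) (n i),
        ⟨Nat.findGreatest_le _, Nat.findGreatest_spec (P := fun t => G.Adj x (p i t)) hs hxs⟩,
        fun r hr h => Nat.le_findGreatest hr h⟩
    have hst : s + 3 ≤ t := hx.lt_of_neighbors_on_one_path ha hb hc (hsmin t ht hxt) ht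
      (by
        intro j r hr h
        obtain rfl := hone j r hr h
        exact ⟨rfl, hsmin r hr h, htmax r hr h⟩)
    have h1 := hbd i s hs hxs
    have h2 := hbd i t ht hxt
    exact hsh.not_neighbors_spread_on_one_path hℓ hc (hsum hij hik hjk) hij hik hjk hoff hst ht
      hxs hxt (fun r hr h => ⟨hsmin r hr h, htmax r hr h⟩)
      (fun r hr h => hij (hone j r hr h).symm) (fun r hr h => hik (hone k r hr h).symm)
      (by omega)
  · push Not at hone
    obtain ⟨j, t₀, ht₀, hxt₀, hji⟩ := hone
    have hij : i ≠ j := hji.symm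
    obtain ⟨k, hik, hjk⟩ := exists_third hij
    have hk : ∀ r ≤ n k, ¬ G.Adj x (p k r) := fun r hr h =>
      hno ⟨p i s₀, p j t₀, p k r, hmem _ _, hmem _ _, hmem _ _, hxs₀, hxt₀, h,
        hc.disj i j hij s₀ hs₀ t₀ ht₀, hc.disj i k hik s₀ hs₀ r hr, hc.disj j k hjk t₀ ht₀ r hr,
        hcross i j hij s₀ hs₀ t₀ ht₀ hxs₀ hxt₀, hcross i k hik s₀ hs₀ r hr hxs₀ h,
        hcross j k hjk t₀ ht₀ r hr hxt₀ h⟩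
    have hclose : ∀ i j, i ≠ j → ∀ t ≤ n j, G.Adj x (p j t) → ∀ r ≤ n i, ∀ r' ≤ n i,
        G.Adj x (p i r) → G.Adj x (p i r') → r ≤ r' + 1 := by
      intro i j hij t ht hxt r hr r' hr' h h'
      by_contra hlt
      exact hno ⟨p i r, p i r', p j t, hmem _ _, hmem _ _, hmem _ _, h, h', hxt,
        fun he => by have := hc.inj i r hr r' hr' he; omega,
        hc.disj i j hij r hr t ht, hc.disj i j hij r' hr' t ht,
        fun he => by have := hc.adj_same i r hr r' hr' he; omega,
        hcross i j hij r hr t ht h hxt, hcross i j hij r' hr' t ht h' hxt⟩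
    have hsingle : ∀ i j, i ≠ j → i ≠ k → j ≠ k → ∀ s₀ ≤ n i, G.Adj x (p i s₀) →
        ∀ r ≤ n j, ∀ r' ≤ n j, G.Adj x (p j r) → G.Adj x (p j r') → ¬ r < r' := by
      intro i j hij hik hjk s₀ hs₀ hxs₀ r hr r' hr' hxr hxr' hlt
      have hex : ∃ s, s ≤ n i ∧ G.Adj x (p i s) := ⟨s₀, hs₀, hxs₀⟩
      obtain ⟨s, ⟨hs, hxs⟩, hsmin⟩ :
          ∃ s, (s ≤ n i ∧ G.Adj x (p i s)) ∧ ∀ r ≤ n i, G.Adj x (p i r) → s ≤ r :=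
        ⟨Nat.find hex, Nat.find_spec hex, fun r hr h => Nat.find_min' hex ⟨hr, h⟩⟩
      have hcl := hclose j i hij.symm s hs hxs
      obtain rfl : r' = r + 1 := by
        have := hcl r' hr' r hr hxr' hxr
        omega
      have h1 := hbd i s hs hxs
      have h2 := hbd j r hr hxr
      have h3 := hbd j (r + 1) hr' hxr'
      refine hsh.not_adjacent_neighbors_on_path hℓ hc (hsum hij hik hjk) hij hik hjk hoff
        (by omega) (by omega) hxs hxr hxr' hsmin (fun t ht h => ?_) hk (by omega) (by omega)
      have h4 := hcl t ht r hr h hxr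
      have h5 := hcl (r + 1) hr' t ht hxr' h
      omega
    have h1 := hbd i s₀ hs₀ hxs₀
    have h2 := hbd j t₀ ht₀ hxt₀
    refine hnt (hc.hasLongTheta hij hoff (by omega) (by omega) (by omega) (by omega) hxs₀ hxt₀
      (fun r hr h => ?_) (fun r hr h => ?_) (by omega) (by omega))
    · have h3 := hsingle j i hij.symm hjk hik t₀ ht₀ hxt₀
      have h4 := h3 r hr s₀ hs₀ h hxs₀
      have h5 := h3 s₀ hs₀ r hr hxs₀ h
      omega
    · have h3 := hsingle i j hij hik hjk s₀ hs₀ hxs₀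
      have h4 := h3 r hr t₀ ht₀ h hxt₀
      have h5 := h3 t₀ ht₀ r hr hxt₀ h
      omega
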